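/- Let N ≥ 1, 1 ≤ n ≤ N, 0 < ε ≤ 1 and 0 < δ < ε/3. There is a constant C = C(ε, δ), independent of N and of n, such that for every γ ∈ L¹(ℝ^N) with ‖γ‖_{𝔅_ε(ℝ^N)} < ∞, the function Mγ(s_1, …, s_N) := s_1^{n−1} γ(s_1, s_1 s_2, …, s_1 s_n, s_{n+1}, …, s_N) belongs to L¹(ℝ^N) and satisfies ‖Mγ‖_{𝔅_δ(ℝ^N)} ≤ C · n · ‖γ‖_{𝔅_ε(ℝ^N)}. -/

import Mathlib

open MeasureTheory
open scoped ENNReal NNReal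

noncomputable section

/-- The norm `‖γ‖_{𝔅_ε(ℝ^N)}`. -/
noncomputable def fB (N : ℕ) (ε : ℝ) (γ : (Fin N → ℝ) → ℂ) : ℝ≥0∞ :=
  (⨆ i : Fin N, ∫⁻ s : Fin N → ℝ,
      ENNReal.ofReal ((1 + |s i|) ^ ε) * (‖γ s‖₊ : ℝ≥0∞)) +
  ⨆ i : Fin N, ⨆ h : Set.Ioc (0 : ℝ) 1,
    ENNReal.ofReal ((h : ℝ) ^ (-ε)) *
      ∫⁻ s : Fin N → ℝ,
        (‖γ (s + (h : ℝ) • (Pi.single i 1 : Fin N → ℝ)) - γ s‖₊ : ℝ≥0∞)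

/-- The multiplicative shear
`Mγ(s_1,…,s_N) = s_1^{n−1} γ(s_1, s_1 s_2, …, s_1 s_n, s_{n+1}, …, s_N)`
(here `N` is replaced by `N+1` so that `N+1 ≥ 1`). -/
noncomputable def Mop (N n : ℕ) (γ : (Fin (N + 1) → ℝ) → ℂ) : (Fin (N + 1) → ℝ) → ℂ :=
  fun s => (((s 0) ^ (n - 1) : ℝ) : ℂ) *
    γ (fun i => if (i : ℕ) = 0 then s 0 else if (i : ℕ) < n then s 0 * s i else s i)

lemma lintegral_comp_diag {N : ℕ} (D : Fin N → ℝ) (hD : ∏ j, D j ≠ 0)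
    {F : (Fin N → ℝ) → ℝ≥0∞} (hF : Measurable F) :
    ∫⁻ y : Fin N → ℝ, ENNReal.ofReal |∏ j, D j| * F (fun j => D j * y j) = ∫⁻ y, F y := by
  have h : (Matrix.diagonal D).det ≠ 0 := by rwa [Matrix.det_diagonal]
  conv_rhs => rw [← Real.smul_map_diagonal_volume_pi h]
  have hmap : (⇑(Matrix.toLin' (Matrix.diagonal D)) : (Fin N → ℝ) → _) =
      fun (y : Fin N → ℝ) j => D j * y j := by
    ext y j
    simp [Matrix.mulVec_diagonal]
  rw [hmap, lintegral_smul_measure, lintegral_map hF (by fun_prop), Matrix.det_diagonal,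
    lintegral_const_mul _ (by fun_prop)]
  rfl

lemma lintegral_fin_cons {N : ℕ} {F : (Fin (N + 1) → ℝ) → ℝ≥0∞} (hF : Measurable F) :
    ∫⁻ s, F s = ∫⁻ t : ℝ, ∫⁻ y : Fin N → ℝ, F (Fin.cons t y) := by
  have h := (volume_preserving_piFinSuccAbove (fun _ : Fin (N + 1) => ℝ) 0).symm
  rw [← h.lintegral_comp_emb (MeasurableEquiv.measurableEmbedding _) F, Measure.volume_eq_prod,
    lintegral_prod _ (by fun_prop)]
  simp [MeasurableEquiv.piFinSuccAbove, Fin.insertNthEquiv, Fin.insertNth_zero']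

/-- Multiplication by `c` of the coordinates with index in `J`. -/
def dil {N : ℕ} (J : Finset (Fin N)) (c : ℝ) (s : Fin N → ℝ) : Fin N → ℝ :=
  fun i => if i ∈ J then c * s i else s i

@[fun_prop]
lemma measurable_dil {N : ℕ} (J : Finset (Fin N)) {α : Type*} [MeasurableSpace α] {c : α → ℝ}
    {s : α → Fin N → ℝ} (hc : Measurable c) (hs : Measurable s) :
    Measurable fun x => dil J (c x) (s x) := by
  refine measurable_pi_iff.2 fun i => ?_
  unfold dil
  split_ifs <;> fun_prop

lemma dil_zero {N : ℕ} {J : Finset (Fin (N + 1))} (hJ : 0 ∉ J) (c : ℝ) (s : Fin (N + 1) → ℝ) :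
    dil J c s 0 = s 0 := by
  simp [dil, hJ]

lemma lintegral_dil {N : ℕ} {J : Finset (Fin (N + 1))} (hJ : 0 ∉ J) {c : ℝ → ℝ}
    (hc : Measurable c) {A : Set ℝ} (hA : MeasurableSet A) (hcA : ∀ t ∈ A, c t ≠ 0)
    {F : (Fin (N + 1) → ℝ) → ℝ≥0∞} (hF : Measurable F) :
    ∫⁻ s in {s | s 0 ∈ A}, ENNReal.ofReal (|c (s 0)| ^ J.card) * F (dil J (c (s 0)) s) =
      ∫⁻ s in {s | s 0 ∈ A}, F s := by
  have hA' : MeasurableSet {s : Fin (N + 1) → ℝ | s 0 ∈ A} := (measurable_pi_apply 0) hA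
  rw [← lintegral_indicator hA', ← lintegral_indicator hA',
    lintegral_fin_cons (Measurable.indicator (by fun_prop) hA'),
    lintegral_fin_cons (Measurable.indicator (by fun_prop) hA')]
  refine lintegral_congr fun t => ?_
  by_cases ht : t ∈ A
  swap
  · simp [Set.indicator, ht]
  simp only [Set.indicator, Set.mem_ofPred_eq, Fin.cons_zero, ht, if_true]
  have hprod : ∏ j : Fin N, (if j.succ ∈ J then c t else 1) = c t ^ J.card := by
    have := Fin.prod_univ_succ (fun i : Fin (N + 1) => if i ∈ J then c t else 1)
    simp only [hJ, if_false, one_mul] at this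
    rw [← this]
    simp [Finset.prod_ite_mem]
  have hd : ∀ y : Fin N → ℝ, dil J (c t) (Fin.cons t y : Fin (N + 1) → ℝ) =
      Fin.cons t (fun j => (if j.succ ∈ J then c t else 1) * y j) := by
    intro y
    ext i
    refine Fin.cases ?_ (fun j => ?_) i
    · simp [dil, hJ]
    · simp only [dil, Fin.cons_succ]
      split_ifs <;> simp
  simp_rw [hd]
  rw [← lintegral_comp_diag (fun j : Fin N => if j.succ ∈ J then c t else 1)
    (by rw [hprod]; exact pow_ne_zero _ (hcA t ht)) (F := fun y => F (Fin.cons t y)) (by fun_prop)]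
  rw [hprod, abs_pow]

lemma lintegral_shear {N : ℕ} {i : Fin (N + 1)} (hi : i ≠ 0) {c : ℝ → ℝ} (hc : Measurable c)
    {F : (Fin (N + 1) → ℝ) → ℝ≥0∞} (hF : Measurable F) :
    ∫⁻ s, F (s + c (s 0) • Pi.single i 1) = ∫⁻ s, F s := by
  obtain ⟨j, rfl⟩ := Fin.exists_succ_eq.2 hi
  rw [lintegral_fin_cons hF, lintegral_fin_cons (by fun_prop)]
  refine lintegral_congr fun t => ?_
  rw [← lintegral_add_right_eq_self (fun y => F (Fin.cons t y)) (c t • Pi.single j 1)]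
  refine lintegral_congr fun y => ?_
  congr 1
  ext k
  refine Fin.cases ?_ (fun k => ?_) k
  · simp
  · simp [Pi.single_apply]

/-- A variable shift in the direction `v` costs no more than a constant times the worst
constant shift of comparable size. -/
lemma lintegral_enorm_shift_sub_le {M : ℕ} (v : Fin M → ℝ) {f : (Fin M → ℝ) → ℂ}
    (hf : Measurable f) {φ : (Fin M → ℝ) → ℝ} (hφ : Measurable φ) {S : Set (Fin M → ℝ)}
    (hS : MeasurableSet S) {L : ℝ} (hL : 0 < L) (hφL : ∀ s ∈ S, |φ s| ≤ L)
    (hΨ : ∀ F : (Fin M → ℝ) → ℝ≥0∞, Measurable F →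
      ∫⁻ s in S, F (s + φ s • v) ≤ 2 * ∫⁻ s, F s)
    {B : ℝ≥0∞} (hB : ∀ m : ℝ, |m| ≤ 2 * L → ∫⁻ s, ‖f (s + m • v) - f s‖ₑ ≤ B) :
    ∫⁻ s in S, ‖f (s + φ s • v) - f s‖ₑ ≤ 6 * B := by
  set P : (Fin M → ℝ) → ℝ≥0∞ := fun y =>
    ∫⁻ m in Set.Icc (-(2 * L)) (2 * L), ‖f (y + m • v) - f y‖ₑ with hP
  have hPm : Measurable P := by
    refine Measurable.lintegral_prod_right' (f := fun p : (Fin M → ℝ) × ℝ =>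
      ‖f (p.1 + p.2 • v) - f p.1‖ₑ) ?_
    fun_prop
  have hPint : ∫⁻ y, P y ≤ ENNReal.ofReal (4 * L) * B := by
    rw [hP, lintegral_lintegral_swap (by unfold Function.uncurry; fun_prop)]
    calc _ ≤ ∫⁻ m in Set.Icc (-(2 * L)) (2 * L), B :=
          setLIntegral_mono' measurableSet_Icc fun m hm => hB m (abs_le.2 hm)
      _ = _ := by
          rw [setLIntegral_const, Real.volume_Icc, mul_comm]
          ring_nf
  have hpt : ∀ s ∈ S, ENNReal.ofReal (2 * L) * ‖f (s + φ s • v) - f s‖ₑ ≤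
      P (s + φ s • v) + P s := by
    intro s hs
    have hsL := abs_le.1 (hφL s hs)
    calc _ = ∫⁻ m in Set.Icc (-L) L, ‖f (s + φ s • v) - f s‖ₑ := by
          rw [setLIntegral_const, Real.volume_Icc, mul_comm]
          ring_nf
      _ ≤ ∫⁻ m in Set.Icc (-L) L, (‖f ((s + φ s • v) + (m - φ s) • v) - f (s + φ s • v)‖ₑ
            + ‖f (s + m • v) - f s‖ₑ) := by
          refine lintegral_mono fun m => ?_
          have : (s + φ s • v) + (m - φ s) • v = s + m • v := by
            rw [sub_smul]; abel
          rw [this, ← enorm_neg (f (s + m • v) - f (s + φ s • v))]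
          refine le_trans (le_of_eq ?_) (enorm_add_le _ _)
          congr 1
          ring
      _ = (∫⁻ m in Set.Icc (-L) L,
            ‖f ((s + φ s • v) + (m - φ s) • v) - f (s + φ s • v)‖ₑ) +
            ∫⁻ m in Set.Icc (-L) L, ‖f (s + m • v) - f s‖ₑ :=
          lintegral_add_left (by fun_prop) _
      _ ≤ _ := by
          refine add_le_add ?_ (lintegral_mono_set (Set.Icc_subset_Icc (by linarith) (by linarith)))
          simp only [hP]
          rw [← lintegral_indicator measurableSet_Icc, ← lintegral_indicator measurableSet_Icc,
            ← lintegral_sub_right_eq_self (μ := volume) ((Set.Icc (-(2 * L)) (2 * L)).indicator _) (φ s)]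
          refine lintegral_mono fun m => ?_
          by_cases hm : m ∈ Set.Icc (-L) L
          · have : m - φ s ∈ Set.Icc (-(2 * L)) (2 * L) :=
              ⟨by linarith [hm.1], by linarith [hm.2]⟩
            simp only [Set.indicator_of_mem hm, Set.indicator_of_mem this, le_refl]
          · simp only [Set.indicator_of_notMem hm, zero_le]
  have h2L : ENNReal.ofReal (2 * L) ≠ 0 := by simp [hL]
  rw [← ENNReal.mul_le_mul_iff_right h2L ENNReal.ofReal_ne_top]
  calc _ = ∫⁻ s in S, ENNReal.ofReal (2 * L) * ‖f (s + φ s • v) - f s‖ₑ :=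
        (lintegral_const_mul _ (by fun_prop)).symm
    _ ≤ ∫⁻ s in S, (P (s + φ s • v) + P s) := setLIntegral_mono' hS hpt
    _ = (∫⁻ s in S, P (s + φ s • v)) + ∫⁻ s in S, P s := lintegral_add_right _ hPm
    _ ≤ 2 * (∫⁻ s, P s) + ∫⁻ s, P s := add_le_add (hΨ P hPm) (setLIntegral_le_lintegral _ _)
    _ = 3 * ∫⁻ s, P s := by ring
    _ ≤ 3 * (ENNReal.ofReal (4 * L) * B) := by gcongr
    _ = _ := by
        rw [show 4 * L = 2 * (2 * L) by ring, ENNReal.ofReal_mul zero_le_two]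
        simp only [ENNReal.ofReal_ofNat]
        ring

lemma lintegral_dil_sub_le {N : ℕ} {c : ℝ → ℝ} (hc : Measurable c) {A : Set ℝ}
    (hA : MeasurableSet A) (hcA : ∀ t ∈ A, c t ≠ 0) {f : (Fin (N + 1) → ℝ) → ℂ}
    (hf : Measurable f) {B : ℝ≥0∞}
    (hB : ∀ j ≠ 0, ∫⁻ s in {s | s 0 ∈ A},
      ‖(c (s 0) : ℂ) * f (dil {j} (c (s 0)) s) - f s‖ₑ ≤ B)
    (J : Finset (Fin (N + 1))) (hJ : 0 ∉ J) :
    ∫⁻ s in {s | s 0 ∈ A}, ‖(c (s 0) : ℂ) ^ J.card * f (dil J (c (s 0)) s) - f s‖ₑ ≤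
      J.card * B := by
  induction J using Finset.induction_on with
  | empty =>
    have hdil : ∀ (x : ℝ) (s : Fin (N + 1) → ℝ), dil ∅ x s = s := fun x s => by ext; simp [dil]
    simp [hdil]
  | insert j J hj ih =>
    have hj0 : j ≠ 0 := fun h => hJ (by simp [h])
    have hJ0 : 0 ∉ J := fun h => hJ (by simp [h])
    have hdil : ∀ s : Fin (N + 1) → ℝ, dil (insert j J) (c (s 0)) s =
        dil {j} (c (s 0)) (dil J (c (s 0)) s) := by
      intro s
      ext i
      by_cases hij : i = j
      · subst hij; simp [dil, hj]
      · simp [dil, hij]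
    have hF : Measurable fun s : Fin (N + 1) → ℝ =>
        ‖(c (s 0) : ℂ) * f (dil {j} (c (s 0)) s) - f s‖ₑ := by fun_prop
    calc _ ≤ ∫⁻ s in {s | s 0 ∈ A}, (ENNReal.ofReal (|c (s 0)| ^ J.card) *
            (fun s => ‖(c (s 0) : ℂ) * f (dil {j} (c (s 0)) s) - f s‖ₑ) (dil J (c (s 0)) s) +
            ‖(c (s 0) : ℂ) ^ J.card * f (dil J (c (s 0)) s) - f s‖ₑ) := by
          refine lintegral_mono fun s => ?_
          simp only [dil_zero hJ0]
          rw [Finset.card_insert_of_notMem hj, hdil]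
          have hn : ENNReal.ofReal (|c (s 0)| ^ J.card) = ‖(c (s 0) : ℂ) ^ J.card‖ₑ := by
            rw [← ofReal_norm]; simp
          rw [hn, ← enorm_mul]
          refine le_trans (le_of_eq ?_) (enorm_add_le _ _)
          congr 1
          ring
      _ = (∫⁻ s in {s | s 0 ∈ A}, ENNReal.ofReal (|c (s 0)| ^ J.card) *
            (fun s => ‖(c (s 0) : ℂ) * f (dil {j} (c (s 0)) s) - f s‖ₑ) (dil J (c (s 0)) s)) +
            ∫⁻ s in {s | s 0 ∈ A},
              ‖(c (s 0) : ℂ) ^ J.card * f (dil J (c (s 0)) s) - f s‖ₑ :=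
          lintegral_add_right _ (by fun_prop)
      _ ≤ B + J.card * B := by
          rw [lintegral_dil hJ0 hc hA hcA hF]
          exact add_le_add (hB j hj0) (ih hJ0)
      _ = _ := by
          rw [Finset.card_insert_of_notMem hj]
          push_cast
          ring

/-- A finite measure on `ℝ` with Hölder-type control of its translation defect charges short
intervals little. -/
lemma measure_Ico_le_of_shift {η : ℝ} (hη0 : 0 < η) (hη1 : η < 1) {μ : Measure ℝ} {K : ℝ≥0∞}
    (hK : μ Set.univ ≤ K)
    (hμ : ∀ a r : ℝ, 0 < r → r ≤ 1 →
      μ (Set.Ico a (a + r)) ≤ μ (Set.Ico (a + r) (a + 2 * r)) + ENNReal.ofReal (r ^ η) * K)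
    (a r : ℝ) (hr : 0 < r) :
    μ (Set.Ico a (a + r)) ≤ ENNReal.ofReal ((2 - 2 ^ η)⁻¹ * r ^ η) * K := by
  set D : ℝ := (2 - 2 ^ η)⁻¹ with hD
  have h1 : (1 : ℝ) < 2 ^ η := Real.one_lt_rpow one_lt_two hη0
  have h2 : (2 : ℝ) ^ η < 2 := by
    simpa using Real.rpow_lt_rpow_of_exponent_lt one_lt_two hη1
  have hD1 : 1 ≤ D := (one_le_inv₀ (by linarith)).2 (by linarith)
  have hDeq : D * 2 ^ η + 1 = 2 * D := by
    have : D * (2 - 2 ^ η) = 1 := inv_mul_cancel₀ (by linarith)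
    linarith
  have base : ∀ a r : ℝ, 1 ≤ r → μ (Set.Ico a (a + r)) ≤ ENNReal.ofReal (D * r ^ η) * K := by
    intro a r hr
    have : (1 : ℝ) ≤ D * r ^ η := one_le_mul_of_one_le_of_one_le hD1 (Real.one_le_rpow hr hη0.le)
    calc _ ≤ μ Set.univ := measure_mono (Set.subset_univ _)
      _ ≤ 1 * K := by simpa using hK
      _ ≤ _ := by gcongr; simpa using this
  have key : ∀ k : ℕ, ∀ a r : ℝ, (1 / 2) ^ k ≤ r →
      μ (Set.Ico a (a + r)) ≤ ENNReal.ofReal (D * r ^ η) * K := by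
    intro k
    induction k with
    | zero => simpa using base
    | succ k ih =>
      intro a r hkr
      rcases le_or_gt 1 r with h | h
      · exact base a r h
      have hr0 : 0 < r := lt_of_lt_of_le (by positivity) hkr
      have hsum : μ (Set.Ico a (a + 2 * r)) =
          μ (Set.Ico a (a + r)) + μ (Set.Ico (a + r) (a + 2 * r)) := by
        rw [← Set.Ico_union_Ico_eq_Ico (b := a + r) (by linarith) (by linarith),
          measure_union Set.Ico_disjoint_Ico_same measurableSet_Ico]
      rw [← ENNReal.mul_le_mul_iff_right two_ne_zero ENNReal.ofNat_ne_top]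
      calc 2 * μ (Set.Ico a (a + r)) = μ (Set.Ico a (a + r)) + μ (Set.Ico a (a + r)) := two_mul _
        _ ≤ μ (Set.Ico a (a + r)) +
            (μ (Set.Ico (a + r) (a + 2 * r)) + ENNReal.ofReal (r ^ η) * K) := by
            gcongr; exact hμ a r hr0 h.le
        _ = μ (Set.Ico a (a + 2 * r)) + ENNReal.ofReal (r ^ η) * K := by rw [hsum, add_assoc]
        _ ≤ ENNReal.ofReal (D * (2 * r) ^ η) * K + ENNReal.ofReal (r ^ η) * K := by
            gcongr
            refine ih a (2 * r) ?_
            rw [pow_succ] at hkr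
            linarith
        _ = ENNReal.ofReal (2 * (D * r ^ η)) * K := by
            rw [← add_mul, ← ENNReal.ofReal_add (by positivity) (by positivity),
              Real.mul_rpow zero_le_two hr0.le, ← mul_assoc 2 D, ← hDeq]
            ring_nf
        _ = _ := by rw [ENNReal.ofReal_mul zero_le_two, mul_assoc]; simp
  obtain ⟨k, hk⟩ := exists_pow_lt_of_lt_one hr (show (1 / 2 : ℝ) < 1 by norm_num)
  exact key k a r hk.le

lemma exists_lintegral_rpow_neg_le {η a D : ℝ} (ha0 : 0 < a) (haη : a < η) (hD : 0 < D) :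
    ∃ C : ℝ, 0 < C ∧ ∀ (μ : Measure ℝ) (K : ℝ≥0∞), μ Set.univ ≤ K →
      (∀ r : ℝ, 0 < r → μ (Set.Ico (-r) r) ≤ ENNReal.ofReal (D * r ^ η) * K) →
      ∫⁻ t, ENNReal.ofReal (|t| ^ (-a)) ∂μ ≤ ENNReal.ofReal C * K := by
  set u : ℕ → ℝ := fun k => ((1 / 2 : ℝ) ^ (k + 1)) ^ (-a) * (D * (2 * (1 / 2) ^ k) ^ η) with hu
  have hu0 : ∀ k, 0 ≤ u k := fun k => by positivity
  have husum : Summable u := by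
    have : u = fun k => ((1 / 2 : ℝ) ^ (-a) * D * 2 ^ η) * ((1 / 2 : ℝ) ^ (η - a)) ^ k := by
      ext k
      simp only [hu]
      rw [Real.mul_rpow (by positivity) (by positivity), ← Real.rpow_natCast, ← Real.rpow_natCast,
        ← Real.rpow_natCast, ← Real.rpow_mul (by positivity), ← Real.rpow_mul (by positivity),
        ← Real.rpow_mul (by positivity)]
      have : (1 / 2 : ℝ) ^ (((k + 1 : ℕ) : ℝ) * -a) * (1 / 2) ^ ((k : ℝ) * η) =
          (1 / 2) ^ (-a) * (1 / 2) ^ ((η - a) * k) := by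
        rw [← Real.rpow_add (by norm_num), ← Real.rpow_add (by norm_num)]
        push_cast
        ring_nf
      linear_combination (D * 2 ^ η) * this
    rw [this]
    refine (summable_geometric_of_lt_one (by positivity) ?_).mul_left _
    exact Real.rpow_lt_one (by norm_num) (by norm_num) (by linarith)
  refine ⟨1 + ∑' k, u k, by have : 0 ≤ ∑' k, u k := tsum_nonneg hu0; positivity, fun μ K hK hμ => ?_⟩
  have hpt : ∀ t : ℝ, ENNReal.ofReal (|t| ^ (-a)) ≤ 1 + ∑' k : ℕ,
      (Set.Ico (-(2 * (1 / 2 : ℝ) ^ k)) (2 * (1 / 2) ^ k)).indicator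
        (fun _ => ENNReal.ofReal (((1 / 2 : ℝ) ^ (k + 1)) ^ (-a))) t := by
    intro t
    rcases eq_or_ne t 0 with rfl | ht
    · simp [Real.zero_rpow (neg_ne_zero.2 ha0.ne')]
    have ht' : 0 < |t| := abs_pos.2 ht
    rcases le_or_gt 1 |t| with h | h
    · refine le_trans ?_ le_self_add
      simpa using Real.rpow_le_one_of_one_le_of_nonpos h (by linarith)
    · obtain ⟨k, hk1, hk2⟩ := exists_nat_pow_near_of_lt_one ht' h.le
        (show (0 : ℝ) < 1 / 2 by norm_num) (by norm_num)
      refine le_trans ?_ le_add_self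
      refine le_trans ?_ (ENNReal.le_tsum k)
      have hk0 : (0 : ℝ) < (1 / 2) ^ k := by positivity
      rw [Set.indicator_of_mem]
      · exact ENNReal.ofReal_le_ofReal
          (Real.rpow_le_rpow_of_nonpos (by positivity) hk1.le (by linarith))
      · exact ⟨by linarith [neg_abs_le t], by linarith [le_abs_self t]⟩
  calc _ ≤ ∫⁻ t, (1 + ∑' k : ℕ, (Set.Ico (-(2 * (1 / 2 : ℝ) ^ k)) (2 * (1 / 2) ^ k)).indicator
        (fun _ => ENNReal.ofReal (((1 / 2 : ℝ) ^ (k + 1)) ^ (-a))) t) ∂μ := lintegral_mono hpt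
    _ = μ Set.univ + ∑' k : ℕ, ENNReal.ofReal (((1 / 2 : ℝ) ^ (k + 1)) ^ (-a)) *
          μ (Set.Ico (-(2 * (1 / 2 : ℝ) ^ k)) (2 * (1 / 2) ^ k)) := by
        rw [lintegral_add_left measurable_const, lintegral_one, lintegral_tsum
          fun k => (measurable_const.indicator measurableSet_Ico).aemeasurable]
        simp_rw [lintegral_indicator_const measurableSet_Ico]
    _ ≤ K + ∑' k : ℕ, ENNReal.ofReal (u k) * K := by
        refine add_le_add hK (ENNReal.tsum_le_tsum fun k => ?_)
        simp only [hu]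
        rw [ENNReal.ofReal_mul (by positivity), mul_assoc]
        gcongr
        exact hμ _ (by positivity)
    _ = _ := by
        rw [ENNReal.tsum_mul_right, ← ENNReal.ofReal_tsum_of_nonneg hu0 husum,
          ENNReal.ofReal_add zero_le_one (tsum_nonneg hu0)]
        simp [add_mul]

lemma lintegral_dil_self {N : ℕ} {J : Finset (Fin (N + 1))} (hJ : 0 ∉ J)
    {F : (Fin (N + 1) → ℝ) → ℝ≥0∞} (hF : Measurable F) :
    ∫⁻ s, ENNReal.ofReal (|s 0| ^ J.card) * F (dil J (s 0) s) = ∫⁻ s, F s := by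
  have h := lintegral_dil hJ measurable_id (A := {0}ᶜ) (measurableSet_singleton 0).compl
    (fun t ht => ht) hF
  have hae : ({s : Fin (N + 1) → ℝ | s 0 ∈ ({0}ᶜ : Set ℝ)} : Set _) =ᵐ[volume] Set.univ := by
    refine Filter.eventuallyEq_univ.2 ?_
    rw [mem_ae_iff]
    refine Eq.trans (congrArg volume ?_) (Measure.pi_hyperplane (fun _ => volume) 0 0)
    ext s
    simp
  rwa [setLIntegral_congr hae, setLIntegral_congr hae, setLIntegral_univ, setLIntegral_univ] at h

/-- `K` dominates the moments and the translation defects of order `η` of `f`. -/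
structure BesovBound {N : ℕ} (η : ℝ) (f : (Fin N → ℝ) → ℂ) (K : ℝ≥0∞) : Prop where
  measurable : Measurable f
  moment : ∀ i, ∫⁻ s, ENNReal.ofReal ((1 + |s i|) ^ η) * ‖f s‖ₑ ≤ K
  shift : ∀ i, ∀ h : ℝ, 0 < h → h ≤ 1 →
    ∫⁻ s, ‖f (s + h • Pi.single i 1) - f s‖ₑ ≤ ENNReal.ofReal (h ^ η) * K

namespace BesovBound

variable {N : ℕ} {η : ℝ} {f : (Fin N → ℝ) → ℂ} {K : ℝ≥0∞}

lemma lintegral_enorm_le (H : BesovBound η f K) (hη : 0 ≤ η) (i : Fin N) :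
    ∫⁻ s, ‖f s‖ₑ ≤ K := by
  refine le_trans (lintegral_mono fun s => ?_) (H.moment i)
  refine le_mul_of_one_le_left' ?_
  simpa using Real.one_le_rpow (by linarith [abs_nonneg (s i)]) hη

lemma tail_le (H : BesovBound η f K) (hη : 0 ≤ η) (i : Fin N) {ρ : ℝ} (hρ : 0 < ρ) :
    ∫⁻ s in {s | ρ < |s i|}, ‖f s‖ₑ ≤ ENNReal.ofReal (ρ ^ (-η)) * K := by
  have hf := H.measurable
  have hS : MeasurableSet {s : Fin N → ℝ | ρ < |s i|} :=
    measurableSet_lt measurable_const (by fun_prop)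
  calc _ ≤ ∫⁻ s in {s | ρ < |s i|},
        ENNReal.ofReal (ρ ^ (-η)) * (ENNReal.ofReal ((1 + |s i|) ^ η) * ‖f s‖ₑ) := by
        refine setLIntegral_mono' hS fun s hs => ?_
        rw [← mul_assoc, ← ENNReal.ofReal_mul (by positivity)]
        refine le_mul_of_one_le_left' ?_
        rw [ENNReal.one_le_ofReal, Real.rpow_neg hρ.le, ← div_eq_inv_mul,
          one_le_div (by positivity)]
        refine Real.rpow_le_rpow hρ.le ?_ hη
        have : ρ < |s i| := hs
        linarith
    _ ≤ ∫⁻ s, ENNReal.ofReal (ρ ^ (-η)) * (ENNReal.ofReal ((1 + |s i|) ^ η) * ‖f s‖ₑ) :=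
        setLIntegral_le_lintegral _ _
    _ ≤ _ := by
        rw [lintegral_const_mul _ (by fun_prop)]
        gcongr
        exact H.moment i

lemma shift_le (H : BesovBound η f K) (hη : 0 < η) (i : Fin N) (m : ℝ) :
    ∫⁻ s, ‖f (s + m • Pi.single i 1) - f s‖ₑ ≤ ENNReal.ofReal (2 * |m| ^ η) * K := by
  have hf := H.measurable
  have hpos : ∀ m : ℝ, 0 < m →
      ∫⁻ s, ‖f (s + m • Pi.single i 1) - f s‖ₑ ≤ ENNReal.ofReal (2 * m ^ η) * K := by
    intro m hm
    rcases le_or_gt m 1 with h | h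
    · refine (H.shift i m hm h).trans ?_
      gcongr
      linarith [Real.rpow_nonneg hm.le η]
    · calc _ ≤ ∫⁻ s, (‖f (s + m • Pi.single i 1)‖ₑ + ‖f s‖ₑ) :=
            lintegral_mono fun s => enorm_sub_le
        _ = 2 * ∫⁻ s, ‖f s‖ₑ := by
            rw [lintegral_add_right _ (by fun_prop),
              lintegral_add_right_eq_self (fun s => ‖f s‖ₑ), two_mul]
        _ ≤ 2 * K := by gcongr; exact H.lintegral_enorm_le hη.le i
        _ ≤ _ := by
            gcongr
            rw [← ENNReal.ofReal_ofNat]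
            refine ENNReal.ofReal_le_ofReal ?_
            linarith [Real.one_le_rpow h.le hη.le]
  rcases lt_trichotomy m 0 with h | rfl | h
  · have h' := hpos (-m) (by linarith)
    rw [abs_of_neg h]
    refine le_trans (le_of_eq ?_) h'
    conv_rhs => rw [← lintegral_add_right_eq_self _ (m • Pi.single i 1)]
    refine lintegral_congr fun s => ?_
    rw [← enorm_neg]
    congr 1
    simp
  · simp
  · simpa [abs_of_pos h] using hpos m h

/-- The law of the `i`-th coordinate under the density `‖f‖`. -/
def marginal (f : (Fin N → ℝ) → ℂ) (i : Fin N) : Measure ℝ :=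
  Measure.map (fun s => s i) (volume.withDensity fun s => ‖f s‖ₑ)

lemma marginal_apply (i : Fin N) {A : Set ℝ} (hA : MeasurableSet A) :
    marginal f i A = ∫⁻ s in {s | s i ∈ A}, ‖f s‖ₑ := by
  rw [marginal, Measure.map_apply (measurable_pi_apply i) hA,
    withDensity_apply _ (measurable_pi_apply i hA)]
  rfl

lemma marginal_univ_le (H : BesovBound η f K) (hη : 0 ≤ η) (i : Fin N) :
    marginal f i Set.univ ≤ K := by
  rw [marginal_apply i MeasurableSet.univ]
  exact (setLIntegral_le_lintegral _ _).trans (H.lintegral_enorm_le hη i)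

lemma marginal_Ico_le (H : BesovBound η f K) (hη0 : 0 < η) (hη1 : η < 1) (i : Fin N)
    (a r : ℝ) (hr : 0 < r) :
    marginal f i (Set.Ico a (a + r)) ≤ ENNReal.ofReal ((2 - 2 ^ η)⁻¹ * r ^ η) * K := by
  have hf := H.measurable
  refine measure_Ico_le_of_shift hη0 hη1 (H.marginal_univ_le hη0.le i) (fun a r hr0 hr1 => ?_) a r hr
  have hm : ∀ a b : ℝ, MeasurableSet {s : Fin N → ℝ | s i ∈ Set.Ico a b} := fun a b =>
    measurable_pi_apply i measurableSet_Ico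
  rw [marginal_apply i measurableSet_Ico, marginal_apply i measurableSet_Ico]
  calc _ ≤ ∫⁻ s in {s | s i ∈ Set.Ico a (a + r)},
        (‖f (s + r • Pi.single i 1)‖ₑ + ‖f (s + r • Pi.single i 1) - f s‖ₑ) := by
        refine lintegral_mono fun s => ?_
        refine le_trans (le_of_eq ?_) enorm_sub_le
        congr 1
        ring
    _ = (∫⁻ s in {s | s i ∈ Set.Ico a (a + r)}, ‖f (s + r • Pi.single i 1)‖ₑ) +
        ∫⁻ s in {s | s i ∈ Set.Ico a (a + r)}, ‖f (s + r • Pi.single i 1) - f s‖ₑ :=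
        lintegral_add_left (by fun_prop) _
    _ ≤ _ := by
        refine add_le_add (le_of_eq ?_)
          ((setLIntegral_le_lintegral _ _).trans (H.shift i r hr0 hr1))
        rw [← lintegral_indicator (hm _ _), ← lintegral_indicator (hm _ _)]
        conv_rhs => rw [← lintegral_add_right_eq_self _ (r • Pi.single i 1)]
        refine lintegral_congr fun s => ?_
        have : s ∈ {s : Fin N → ℝ | s i ∈ Set.Ico a (a + r)} ↔
            s + r • Pi.single i 1 ∈ {s : Fin N → ℝ | s i ∈ Set.Ico (a + r) (a + 2 * r)} := by
          simp only [Set.mem_ofPred_eq, Set.mem_Ico, Pi.add_apply, Pi.smul_apply,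
            Pi.single_eq_same, smul_eq_mul, mul_one]
          constructor <;> rintro ⟨h1, h2⟩ <;> constructor <;> linarith
        simp only [Set.indicator, this]

lemma marginal_Ico_neg_le (H : BesovBound η f K) (hη0 : 0 < η) (hη1 : η < 1) (i : Fin N)
    (r : ℝ) (hr : 0 < r) :
    marginal f i (Set.Ico (-r) r) ≤ ENNReal.ofReal (2 * (2 - 2 ^ η)⁻¹ * r ^ η) * K := by
  have h := H.marginal_Ico_le hη0 hη1 i (-r) (2 * r) (by linarith)
  rw [show -r + 2 * r = r by ring, Real.mul_rpow zero_le_two hr.le] at h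
  have h2 : (2 : ℝ) ^ η < 2 := by
    simpa using Real.rpow_lt_rpow_of_exponent_lt one_lt_two hη1
  have h0 : 0 < (2 - (2 : ℝ) ^ η)⁻¹ := inv_pos.2 (by linarith)
  refine h.trans ?_
  rw [← mul_assoc, mul_comm 2]
  gcongr

lemma ball_le (H : BesovBound η f K) (hη0 : 0 < η) (hη1 : η < 1) (i : Fin N)
    {r : ℝ} (hr : 0 < r) :
    ∫⁻ s in {s | |s i| ≤ r}, ‖f s‖ₑ ≤ ENNReal.ofReal (4 * (2 - 2 ^ η)⁻¹ * r ^ η) * K := by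
  have h2 : (2 : ℝ) ^ η < 2 := by
    simpa using Real.rpow_lt_rpow_of_exponent_lt one_lt_two hη1
  have h0 : 0 < (2 - (2 : ℝ) ^ η)⁻¹ := inv_pos.2 (by linarith)
  calc _ ≤ ∫⁻ s in {s | s i ∈ Set.Ico (-(2 * r)) (2 * r)}, ‖f s‖ₑ := by
        refine lintegral_mono_set fun s hs => ?_
        have := abs_le.1 (show |s i| ≤ r from hs)
        exact ⟨by linarith, by linarith⟩
    _ = marginal f i (Set.Ico (-(2 * r)) (2 * r)) := (marginal_apply i measurableSet_Ico).symm
    _ ≤ _ := H.marginal_Ico_neg_le hη0 hη1 i _ (by linarith)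
    _ ≤ _ := by
        gcongr ENNReal.ofReal ?_ * K
        rw [Real.mul_rpow zero_le_two hr.le]
        calc _ = (2 * (2 - (2 : ℝ) ^ η)⁻¹ * r ^ η) * 2 ^ η := by ring
          _ ≤ (2 * (2 - (2 : ℝ) ^ η)⁻¹ * r ^ η) * 2 := by gcongr
          _ = _ := by ring

lemma exists_neg_moment_le {η a : ℝ} (hη1 : η < 1) (ha0 : 0 < a) (haη : a < η) :
    ∃ C : ℝ, 0 < C ∧ ∀ {N : ℕ} {f : (Fin N → ℝ) → ℂ} {K : ℝ≥0∞}, BesovBound η f K →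
      ∀ i, ∫⁻ s, ENNReal.ofReal (|s i| ^ (-a)) * ‖f s‖ₑ ≤ ENNReal.ofReal C * K := by
  have h2 : (2 : ℝ) ^ η < 2 := by
    simpa using Real.rpow_lt_rpow_of_exponent_lt one_lt_two hη1
  have h0 : 0 < (2 - (2 : ℝ) ^ η)⁻¹ := inv_pos.2 (by linarith)
  have hη0 := ha0.trans haη
  obtain ⟨C, hC, h⟩ := exists_lintegral_rpow_neg_le ha0 haη (mul_pos two_pos h0)
  refine ⟨C, hC, fun {N f K} H i => ?_⟩
  have hf := H.measurable
  refine le_trans (le_of_eq ?_) (h _ K (H.marginal_univ_le hη0.le i)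
    (H.marginal_Ico_neg_le hη0 hη1 i))
  rw [marginal, lintegral_map (by fun_prop) (measurable_pi_apply i),
    lintegral_withDensity_eq_lintegral_mul _ (by fun_prop) (by fun_prop)]
  refine lintegral_congr fun s => ?_
  simp [mul_comm]

end BesovBound

lemma dil_singleton {N : ℕ} (j : Fin N) (c : ℝ) (s : Fin N → ℝ) :
    dil {j} c s = s + ((c - 1) * s j) • Pi.single j 1 := by
  ext i
  by_cases hij : i = j
  · subst hij
    simp [dil]
    ring
  · simp [dil, hij]

namespace BesovBound

variable {N : ℕ} {η : ℝ} {f : (Fin (N + 1) → ℝ) → ℂ} {K : ℝ≥0∞}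

lemma shift_le_of_abs_le (H : BesovBound η f K) (hη0 : 0 < η) (hη1 : η ≤ 1) {x : ℝ} (hx0 : 0 < x)
    (i : Fin (N + 1)) {m : ℝ} (hm : |m| ≤ 2 * x) :
    ∫⁻ s, ‖f (s + m • Pi.single i 1) - f s‖ₑ ≤ 4 * (ENNReal.ofReal (x ^ η) * K) := by
  refine (H.shift_le hη0 i m).trans ?_
  have h4 : (4 : ℝ≥0∞) = ENNReal.ofReal 4 := by simp
  rw [h4, ← mul_assoc, ← ENNReal.ofReal_mul (by norm_num)]
  gcongr ENNReal.ofReal ?_ * K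
  have : |m| ^ η ≤ 2 * x ^ η := by
    calc |m| ^ η ≤ (2 * x) ^ η := Real.rpow_le_rpow (abs_nonneg m) hm hη0.le
      _ = 2 ^ η * x ^ η := Real.mul_rpow zero_le_two hx0.le
      _ ≤ 2 ^ (1 : ℝ) * x ^ η := by gcongr; norm_num
      _ = 2 * x ^ η := by simp
  linarith

lemma tail_inv_le (H : BesovBound η f K) (hη0 : 0 ≤ η) (i : Fin (N + 1)) {x : ℝ} (hx0 : 0 < x) :
    ∫⁻ s in {s | x⁻¹ < |s i|}, ‖f s‖ₑ ≤ ENNReal.ofReal (x ^ η) * K := by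
  have h := H.tail_le hη0 i (inv_pos.2 hx0)
  rwa [Real.inv_rpow hx0.le, Real.rpow_neg hx0.le, inv_inv] at h

lemma tail_inv_two_mul_le (H : BesovBound η f K) (hη0 : 0 ≤ η) (hη1 : η ≤ 1) (i : Fin (N + 1))
    {x : ℝ} (hx0 : 0 < x) :
    ∫⁻ s in {s | (2 * x)⁻¹ < |s i|}, ‖f s‖ₑ ≤ 2 * (ENNReal.ofReal (x ^ η) * K) := by
  refine (H.tail_inv_le hη0 i (by positivity)).trans ?_
  have h2 : (2 : ℝ≥0∞) = ENNReal.ofReal 2 := by simp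
  rw [h2, ← mul_assoc, ← ENNReal.ofReal_mul (by norm_num)]
  gcongr
  calc (2 * x) ^ η = 2 ^ η * x ^ η := Real.mul_rpow zero_le_two hx0.le
    _ ≤ 2 ^ (1 : ℝ) * x ^ η := by gcongr; norm_num
    _ = 2 * x ^ η := by simp

lemma lintegral_dil_singleton_sub_le (H : BesovBound η f K) (hη0 : 0 < η) (hη1 : η ≤ 1) {x : ℝ}
    (hx0 : 0 < x) (hx1 : x ≤ 1) {j : Fin (N + 1)} (hj : j ≠ 0) :
    ∫⁻ s in {s | s 0 ∈ {t : ℝ | 2 * x < |t|}},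
      ‖((1 + x ^ 3 / s 0 : ℝ) : ℂ) * f (dil {j} (1 + x ^ 3 / s 0) s) - f s‖ₑ ≤
      28 * (ENNReal.ofReal (x ^ η) * K) := by
  have hf := H.measurable
  set E := ENNReal.ofReal (x ^ η) * K with hE
  set c : ℝ → ℝ := fun t => 1 + x ^ 3 / t with hc
  have hcm : Measurable c := by fun_prop
  set A : Set ℝ := {t : ℝ | 2 * x < |t|} with hA
  have hAm : MeasurableSet A := measurableSet_lt measurable_const (by fun_prop)
  have hA'm : MeasurableSet {s : Fin (N + 1) → ℝ | s 0 ∈ A} := measurable_pi_apply 0 hAm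
  have hc1 : ∀ t ∈ A, |c t - 1| ≤ x ^ 2 / 2 := by
    intro t ht
    have ht' : 2 * x < |t| := ht
    simp only [hc, add_sub_cancel_left, abs_div, abs_pow, abs_of_pos hx0]
    rw [div_le_iff₀ (by linarith)]
    nlinarith [mul_pos hx0 hx0]
  have hx2 : x ^ 2 ≤ 1 := pow_le_one₀ hx0.le hx1
  have hclow : ∀ t ∈ A, 1 / 2 ≤ c t := fun t ht => by linarith [(abs_le.1 (hc1 t ht)).1]
  have hcup : ∀ t ∈ A, c t ≤ 2 := fun t ht => by linarith [(abs_le.1 (hc1 t ht)).2]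
  have hc0 : ∀ t ∈ A, c t ≠ 0 := fun t ht => by linarith [hclow t ht]
  have hj0 : (0 : Fin (N + 1)) ∉ ({j} : Finset _) := by simpa using hj.symm
  set S : Set (Fin (N + 1) → ℝ) := {s | s 0 ∈ A ∧ |s j| ≤ x⁻¹} with hS
  have hSm : MeasurableSet S :=
    hA'm.inter (measurableSet_le (f := fun s : Fin (N + 1) → ℝ => |s j|) (by fun_prop)
      measurable_const)
  set T : Set (Fin (N + 1) → ℝ) := {s | x⁻¹ < |s j|} with hT
  have hTm : MeasurableSet T := measurableSet_lt measurable_const (by fun_prop)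
  set U : Set (Fin (N + 1) → ℝ) := {s | (2 * x)⁻¹ < |s j|} with hU
  have hUm : MeasurableSet U := measurableSet_lt measurable_const (by fun_prop)
  set G : (Fin (N + 1) → ℝ) → ℝ≥0∞ := U.indicator fun s => ‖f s‖ₑ with hG
  have hGm : Measurable G := Measurable.indicator (by fun_prop) hUm
  have hI1 : ∫⁻ s in S, ‖f (dil {j} (c (s 0)) s) - f s‖ₑ ≤ 6 * (2 * E) := by
    simp_rw [dil_singleton]
    refine lintegral_enorm_shift_sub_le (φ := fun s => (c (s 0) - 1) * s j) (Pi.single j 1) hf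
      (by fun_prop) hSm (half_pos hx0) (fun s hs => ?_) (fun F hF => ?_) (fun m hm => ?_)
    · rw [abs_mul]
      calc _ ≤ x ^ 2 / 2 * x⁻¹ := by
            gcongr
            · exact hc1 _ hs.1
            · exact hs.2
        _ = x / 2 := by field_simp
    · simp_rw [← dil_singleton]
      calc _ ≤ ∫⁻ s in {s | s 0 ∈ A}, F (dil {j} (c (s 0)) s) :=
            lintegral_mono_set fun s hs => hs.1
        _ ≤ ∫⁻ s in {s | s 0 ∈ A}, 2 * (ENNReal.ofReal (|c (s 0)| ^ ({j} : Finset _).card) *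
              F (dil {j} (c (s 0)) s)) := by
            refine setLIntegral_mono' hA'm fun s hs => ?_
            rw [← mul_assoc]
            refine le_mul_of_one_le_left' ?_
            have h2 : (2 : ℝ≥0∞) = ENNReal.ofReal 2 := by simp
            rw [h2, ← ENNReal.ofReal_mul (by norm_num), ENNReal.one_le_ofReal]
            have := hclow _ hs
            simp only [Finset.card_singleton, pow_one]
            linarith [le_abs_self (c (s 0))]
        _ = 2 * ∫⁻ s in {s | s 0 ∈ A}, F s := by
            rw [lintegral_const_mul _ (by fun_prop), lintegral_dil hj0 hcm hAm hc0 hF]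
        _ ≤ _ := mul_le_mul_right (setLIntegral_le_lintegral _ _) _
    · refine (H.shift_le hη0 j m).trans ?_
      have h2 : (2 : ℝ≥0∞) = ENNReal.ofReal 2 := by simp
      rw [h2, hE, ← mul_assoc, ← ENNReal.ofReal_mul (by norm_num)]
      gcongr
      linarith
  have hpt : ∀ s ∈ {s : Fin (N + 1) → ℝ | s 0 ∈ A},
      ‖(c (s 0) : ℂ) * f (dil {j} (c (s 0)) s) - f s‖ₑ ≤
        S.indicator (fun s => 2 * ‖f (dil {j} (c (s 0)) s) - f s‖ₑ) s +
        ENNReal.ofReal (x ^ η) * ‖f s‖ₑ +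
        ENNReal.ofReal (|c (s 0)| ^ ({j} : Finset (Fin (N + 1))).card) *
          G (dil {j} (c (s 0)) s) + T.indicator (fun s => ‖f s‖ₑ) s := by
    intro s hs
    have hcn : ENNReal.ofReal (|c (s 0)| ^ ({j} : Finset (Fin (N + 1))).card) =
        ‖(c (s 0) : ℂ)‖ₑ := by
      rw [← ofReal_norm]; simp
    rcases le_or_gt |s j| x⁻¹ with h | h
    · rw [Set.indicator_of_mem (show s ∈ S from ⟨hs, h⟩)]
      refine le_trans ?_ (le_self_add.trans le_self_add)
      calc _ = ‖(c (s 0) : ℂ) * (f (dil {j} (c (s 0)) s) - f s) + ((c (s 0) : ℂ) - 1) * f s‖ₑ := by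
            congr 1; ring
        _ ≤ ‖(c (s 0) : ℂ)‖ₑ * ‖f (dil {j} (c (s 0)) s) - f s‖ₑ +
              ‖(c (s 0) : ℂ) - 1‖ₑ * ‖f s‖ₑ := by
            rw [← enorm_mul, ← enorm_mul]; exact enorm_add_le _ _
        _ ≤ _ := by
            gcongr
            · rw [← hcn, Finset.card_singleton, pow_one]
              have := hclow _ hs
              rw [abs_of_pos (by linarith)]
              exact ENNReal.ofReal_le_of_le_toReal (by simpa using hcup _ hs)
            · rw [← ofReal_norm]
              refine ENNReal.ofReal_le_ofReal ?_
              have : (c (s 0) : ℂ) - 1 = ((c (s 0) - 1 : ℝ) : ℂ) := by push_cast; rfl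
              rw [this, Complex.norm_real, Real.norm_eq_abs]
              have h1 : x ≤ x ^ η := by
                simpa using Real.rpow_le_rpow_of_exponent_ge hx0 hx1 hη1
              nlinarith [hc1 _ hs]
    · have hdU : dil {j} (c (s 0)) s ∈ U := by
        simp only [hU, dil, Set.mem_ofPred_eq, Finset.mem_singleton, if_true, abs_mul]
        have := hclow _ hs
        rw [abs_of_pos (by linarith : 0 < c (s 0)), mul_inv]
        have hxi : 0 < x⁻¹ := inv_pos.2 hx0
        nlinarith
      rw [Set.indicator_of_mem (show s ∈ T from h), hcn, hG, Set.indicator_of_mem hdU]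
      refine le_trans enorm_sub_le ?_
      rw [enorm_mul]
      exact add_le_add_left le_add_self _
  calc _ ≤ _ := setLIntegral_mono' hA'm hpt
    _ = (∫⁻ s in {s | s 0 ∈ A}, S.indicator (fun s => 2 * ‖f (dil {j} (c (s 0)) s) - f s‖ₑ) s) +
        (∫⁻ s in {s | s 0 ∈ A}, ENNReal.ofReal (x ^ η) * ‖f s‖ₑ) +
        (∫⁻ s in {s | s 0 ∈ A}, ENNReal.ofReal (|c (s 0)| ^ ({j} : Finset (Fin (N + 1))).card) *
          G (dil {j} (c (s 0)) s)) +
        ∫⁻ s in {s | s 0 ∈ A}, T.indicator (fun s => ‖f s‖ₑ) s := by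
        rw [lintegral_add_right _ (Measurable.indicator (by fun_prop) hTm),
          lintegral_add_right _ (by fun_prop), lintegral_add_right _ (by fun_prop)]
    _ ≤ 2 * (6 * (2 * E)) + E + 2 * E + E := by
        gcongr
        · refine (setLIntegral_le_lintegral _ _).trans ?_
          rw [lintegral_indicator hSm, lintegral_const_mul _ (by fun_prop)]
          gcongr
        · refine (setLIntegral_le_lintegral _ _).trans ?_
          rw [lintegral_const_mul _ (by fun_prop)]
          exact mul_le_mul_right (H.lintegral_enorm_le hη0.le 0) _
        · rw [lintegral_dil hj0 hcm hAm hc0 hGm]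
          refine (setLIntegral_le_lintegral _ _).trans ?_
          rw [lintegral_indicator hUm]
          exact H.tail_inv_two_mul_le hη0.le hη1 j hx0
        · refine (setLIntegral_le_lintegral _ _).trans ?_
          rw [lintegral_indicator hTm]
          exact H.tail_inv_le hη0.le j hx0
    _ = 28 * E := by ring

lemma lintegral_shear_sub_le (H : BesovBound η f K) (hη0 : 0 < η) (hη1 : η ≤ 1) {x : ℝ}
    (hx0 : 0 < x) (hx1 : x ≤ 1) {i : Fin (N + 1)} (hi : i ≠ 0) :
    ∫⁻ s, ‖f (s + (x ^ 3 * s 0) • Pi.single i 1) - f s‖ₑ ≤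
      26 * (ENNReal.ofReal (x ^ η) * K) := by
  have hf := H.measurable
  set E := ENNReal.ofReal (x ^ η) * K with hE
  set T : Set (Fin (N + 1) → ℝ) := {s | x⁻¹ < |s 0|} with hT
  have hTm : MeasurableSet T := measurableSet_lt measurable_const (by fun_prop)
  have hsh : ∀ F : (Fin (N + 1) → ℝ) → ℝ≥0∞, Measurable F →
      ∫⁻ s, F (s + (x ^ 3 * s 0) • Pi.single i 1) = ∫⁻ s, F s := fun F hF =>
    lintegral_shear hi (c := fun t => x ^ 3 * t) (by fun_prop) hF
  have hT1 : ∫⁻ s in T, ‖f s‖ₑ ≤ E := H.tail_inv_le hη0.le 0 hx0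
  have hT2 : ∫⁻ s in T, ‖f (s + (x ^ 3 * s 0) • Pi.single i 1)‖ₑ ≤ E := by
    refine le_trans (le_of_eq ?_) hT1
    rw [← lintegral_indicator hTm, ← lintegral_indicator hTm]
    conv_rhs => rw [← hsh _ (Measurable.indicator (by fun_prop) hTm)]
    refine lintegral_congr fun s => ?_
    simp [Set.indicator, hT, hi.symm]
  rw [← lintegral_add_compl _ hTm.compl, compl_compl]
  calc _ ≤ 6 * (4 * E) + ∫⁻ s in T, (‖f (s + (x ^ 3 * s 0) • Pi.single i 1)‖ₑ + ‖f s‖ₑ) := by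
        refine add_le_add ?_ (lintegral_mono fun s => enorm_sub_le)
        refine lintegral_enorm_shift_sub_le (φ := fun s => x ^ 3 * s 0) (Pi.single i 1) hf
          (by fun_prop) hTm.compl hx0 (fun s hs => ?_) (fun F hF => ?_)
          (fun m hm => H.shift_le_of_abs_le hη0 hη1 hx0 i hm)
        · have hs' : |s 0| ≤ x⁻¹ := not_lt.1 hs
          rw [abs_mul, abs_of_pos (by positivity)]
          calc _ ≤ x ^ 3 * x⁻¹ := by gcongr
            _ = x * x := by field_simp
            _ ≤ x := mul_le_of_le_one_right hx0.le hx1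
        · refine (setLIntegral_le_lintegral _ _).trans ?_
          rw [hsh F hF, two_mul]
          exact le_self_add
    _ ≤ 6 * (4 * E) + (E + E) := by
        rw [lintegral_add_right _ (by fun_prop)]
        gcongr
    _ = 26 * E := by ring

end BesovBound

/-- The weighted multiplicative shear `s ↦ s₀ ^ |J| f(dil J s₀ s)`. -/
def mulShear {N : ℕ} (J : Finset (Fin (N + 1))) (f : (Fin (N + 1) → ℝ) → ℂ) :
    (Fin (N + 1) → ℝ) → ℂ :=
  fun s => (s 0 : ℂ) ^ J.card * f (dil J (s 0) s)

lemma ofReal_abs_pow_eq_enorm (t : ℝ) (k : ℕ) : ENNReal.ofReal (|t| ^ k) = ‖(t : ℂ) ^ k‖ₑ := by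
  rw [← ofReal_norm]
  simp

lemma measurable_mulShear {N : ℕ} (J : Finset (Fin (N + 1))) {f : (Fin (N + 1) → ℝ) → ℂ}
    (hf : Measurable f) : Measurable (mulShear J f) := by
  unfold mulShear
  fun_prop

lemma lintegral_mulShear {N : ℕ} {J : Finset (Fin (N + 1))} (hJ : 0 ∉ J)
    {f : (Fin (N + 1) → ℝ) → ℂ} (hf : Measurable f) {w : (Fin (N + 1) → ℝ) → ℝ≥0∞}
    (hw : Measurable w) :
    ∫⁻ s, w (dil J (s 0) s) * ‖mulShear J f s‖ₑ = ∫⁻ u, w u * ‖f u‖ₑ := by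
  rw [← lintegral_dil_self hJ (F := fun u => w u * ‖f u‖ₑ) (by fun_prop)]
  refine lintegral_congr fun s => ?_
  rw [mulShear, enorm_mul, ofReal_abs_pow_eq_enorm]
  ring

namespace BesovBound

variable {N : ℕ} {η : ℝ} {f : (Fin (N + 1) → ℝ) → ℂ} {K : ℝ≥0∞}

lemma lintegral_mulShear_ball_le (H : BesovBound η f K) (hη0 : 0 < η) (hη1 : η < 1)
    {J : Finset (Fin (N + 1))} (hJ : 0 ∉ J) {x : ℝ} (hx0 : 0 < x) :
    ∫⁻ s in {s | |s 0| ≤ 3 * x}, ‖mulShear J f s‖ₑ ≤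
      ENNReal.ofReal (12 * (2 - 2 ^ η)⁻¹) * (ENNReal.ofReal (x ^ η) * K) := by
  have hf := H.measurable
  have h2 : (2 : ℝ) ^ η < 2 := by
    simpa using Real.rpow_lt_rpow_of_exponent_lt one_lt_two hη1
  have h0 : 0 < (2 - (2 : ℝ) ^ η)⁻¹ := inv_pos.2 (by linarith)
  set V : Set (Fin (N + 1) → ℝ) := {s | |s 0| ≤ 3 * x} with hV
  have hVm : MeasurableSet V := measurableSet_le (by fun_prop) measurable_const
  calc _ = ∫⁻ s, V.indicator 1 (dil J (s 0) s) * ‖mulShear J f s‖ₑ := by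
        rw [← lintegral_indicator hVm]
        refine lintegral_congr fun s => ?_
        simp [Set.indicator, hV, dil_zero hJ]
    _ = ∫⁻ s in V, ‖f s‖ₑ := by
        rw [lintegral_mulShear hJ hf (measurable_one.indicator hVm), ← lintegral_indicator hVm]
        refine lintegral_congr fun s => ?_
        simp [Set.indicator]
    _ ≤ _ := H.ball_le hη0 hη1 0 (by positivity)
    _ ≤ _ := by
        rw [← mul_assoc, ← ENNReal.ofReal_mul (by positivity)]
        gcongr ENNReal.ofReal ?_ * K
        rw [Real.mul_rpow (by norm_num) hx0.le]
        have h3 : (3 : ℝ) ^ η ≤ 3 := by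
          simpa using Real.rpow_le_rpow_of_exponent_le (show (1 : ℝ) ≤ 3 by norm_num) hη1.le
        calc _ = (4 * (2 - (2 : ℝ) ^ η)⁻¹ * x ^ η) * 3 ^ η := by ring
          _ ≤ (4 * (2 - (2 : ℝ) ^ η)⁻¹ * x ^ η) * 3 := by gcongr
          _ = _ := by ring

lemma shift_pow_three_le (H : BesovBound η f K) (hη0 : 0 < η) {x : ℝ} (hx0 : 0 < x) (hx1 : x ≤ 1)
    (i : Fin (N + 1)) :
    ∫⁻ s, ‖f (s + x ^ 3 • Pi.single i 1) - f s‖ₑ ≤ ENNReal.ofReal (x ^ η) * K := by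
  refine (H.shift i _ (by positivity) (pow_le_one₀ hx0.le hx1)).trans ?_
  gcongr
  exact pow_le_of_le_one hx0.le hx1 three_ne_zero

lemma mulShear_shift_zero_far_le (H : BesovBound η f K) (hη0 : 0 < η) (hη1 : η < 1)
    {J : Finset (Fin (N + 1))} (hJ : 0 ∉ J) {x : ℝ} (hx0 : 0 < x) (hx1 : x ≤ 1) :
    ∫⁻ s in {s | s 0 ∈ {t : ℝ | 2 * x < |t|}},
      ‖mulShear J f (s + x ^ 3 • Pi.single 0 1) - mulShear J f s‖ₑ ≤
      (1 + J.card * 28) * (ENNReal.ofReal (x ^ η) * K) := by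
  have hf := H.measurable
  set E := ENNReal.ofReal (x ^ η) * K with hE
  have hx3 : x ^ 3 ≤ x := pow_le_of_le_one hx0.le hx1 three_ne_zero
  set c : ℝ → ℝ := fun t => 1 + x ^ 3 / t with hc
  have hcm : Measurable c := by fun_prop
  set A : Set ℝ := {t : ℝ | 2 * x < |t|} with hA
  have hAm : MeasurableSet A := measurableSet_lt measurable_const (by fun_prop)
  have hA'm : MeasurableSet {s : Fin (N + 1) → ℝ | s 0 ∈ A} := measurable_pi_apply 0 hAm
  have ht0 : ∀ t ∈ A, t ≠ 0 := by
    rintro t ht rfl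
    have : 2 * x < |(0 : ℝ)| := ht
    rw [abs_zero] at this
    linarith
  have hc0 : ∀ t ∈ A, c t ≠ 0 := by
    intro t ht h
    have h1 : t = -x ^ 3 := by
      simp only [hc] at h
      field_simp [ht0 t ht] at h
      linarith
    have h2 : 2 * x < |t| := ht
    rw [h1, abs_neg, abs_of_pos (by positivity)] at h2
    linarith
  set G : (Fin (N + 1) → ℝ) → ℝ≥0∞ := fun v => ‖f (v + x ^ 3 • Pi.single 0 1) - f v‖ₑ with hG
  have hGm : Measurable G := by fun_prop
  set F : (Fin (N + 1) → ℝ) → ℝ≥0∞ := fun u =>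
    ‖(c (u 0) : ℂ) ^ J.card * f (dil J (c (u 0)) u + x ^ 3 • Pi.single 0 1) - f u‖ₑ with hF
  have hFm : Measurable F := by fun_prop
  calc _ = ∫⁻ s in {s | s 0 ∈ A}, ENNReal.ofReal (|s 0| ^ J.card) * F (dil J (s 0) s) := by
        refine setLIntegral_congr_fun hA'm fun s hs => ?_
        have hs0 : s 0 ≠ 0 := ht0 _ hs
        have hdil : dil J (s 0 + x ^ 3) (s + x ^ 3 • Pi.single 0 1) =
            dil J (c (s 0)) (dil J (s 0) s) + x ^ 3 • Pi.single 0 1 := by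
          ext i
          by_cases hi : i ∈ J
          · have hi0 : i ≠ 0 := fun h => hJ (h ▸ hi)
            simp [dil, hi, hi0, hc]
            field_simp
          · simp [dil, hi]
        simp only [hF, mulShear, dil_zero hJ]
        rw [ofReal_abs_pow_eq_enorm, ← enorm_mul]
        have h00 : (s + x ^ 3 • Pi.single 0 1 : Fin (N + 1) → ℝ) 0 = s 0 + x ^ 3 := by simp
        have hcs : ((s 0 + x ^ 3 : ℝ) : ℂ) = (s 0 : ℂ) * (c (s 0) : ℂ) := by
          rw [← Complex.ofReal_mul]
          congr 1
          simp only [hc]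
          field_simp
        rw [h00, hdil, hcs]
        congr 1
        ring
    _ = ∫⁻ u in {s | s 0 ∈ A}, F u :=
        lintegral_dil hJ measurable_id hAm ht0 hFm
    _ ≤ ∫⁻ u in {s | s 0 ∈ A}, (ENNReal.ofReal (|c (u 0)| ^ J.card) *
          G (dil J (c (u 0)) u) +
          ‖(c (u 0) : ℂ) ^ J.card * f (dil J (c (u 0)) u) - f u‖ₑ) := by
        refine lintegral_mono fun u => ?_
        simp only [hF, hG]
        rw [ofReal_abs_pow_eq_enorm, ← enorm_mul]
        refine le_trans (le_of_eq ?_) (enorm_add_le _ _)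
        congr 1
        ring
    _ ≤ E + J.card * (28 * E) := by
        rw [lintegral_add_right _ (by fun_prop)]
        refine add_le_add ((lintegral_dil hJ hcm hAm hc0 hGm).trans_le
          ((setLIntegral_le_lintegral _ _).trans (H.shift_pow_three_le hη0 hx0 hx1 0)))
          (lintegral_dil_sub_le hcm hAm hc0 hf
            (fun j hj => H.lintegral_dil_singleton_sub_le hη0 hη1.le hx0 hx1 hj) J hJ)
    _ = _ := by ring

lemma mulShear_shift_zero_near_le (H : BesovBound η f K) (hη0 : 0 < η) (hη1 : η < 1)
    {J : Finset (Fin (N + 1))} (hJ : 0 ∉ J) {x : ℝ} (hx0 : 0 < x) (hx1 : x ≤ 1) :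
    ∫⁻ s in {s | s 0 ∈ {t : ℝ | 2 * x < |t|}}ᶜ,
      ‖mulShear J f (s + x ^ 3 • Pi.single 0 1) - mulShear J f s‖ₑ ≤
      2 * ENNReal.ofReal (12 * (2 - 2 ^ η)⁻¹) * (ENNReal.ofReal (x ^ η) * K) := by
  have hf := H.measurable
  have hMm := measurable_mulShear J hf
  have hball := H.lintegral_mulShear_ball_le hη0 hη1 hJ hx0
  set E := ENNReal.ofReal (x ^ η) * K with hE
  have hx3 : x ^ 3 ≤ x := pow_le_of_le_one hx0.le hx1 three_ne_zero
  set A : Set ℝ := {t : ℝ | 2 * x < |t|} with hA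
  have hAm : MeasurableSet A := measurableSet_lt measurable_const (by fun_prop)
  have hA'm : MeasurableSet {s : Fin (N + 1) → ℝ | s 0 ∈ A} := measurable_pi_apply 0 hAm
  have hVm : MeasurableSet {s : Fin (N + 1) → ℝ | |s 0| ≤ 3 * x} :=
    measurableSet_le (by fun_prop) measurable_const
  calc _ ≤ ∫⁻ s in {s | s 0 ∈ A}ᶜ,
        (‖mulShear J f (s + x ^ 3 • Pi.single 0 1)‖ₑ + ‖mulShear J f s‖ₑ) :=
        lintegral_mono fun s => enorm_sub_le
    _ = (∫⁻ s in {s | s 0 ∈ A}ᶜ, ‖mulShear J f (s + x ^ 3 • Pi.single 0 1)‖ₑ) +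
          ∫⁻ s in {s | s 0 ∈ A}ᶜ, ‖mulShear J f s‖ₑ := lintegral_add_right _ (by fun_prop)
    _ ≤ (∫⁻ s in {s | |s 0| ≤ 3 * x}, ‖mulShear J f s‖ₑ) +
          ∫⁻ s in {s | |s 0| ≤ 3 * x}, ‖mulShear J f s‖ₑ := by
        refine add_le_add ?_ (lintegral_mono_set fun s hs => ?_)
        · rw [← lintegral_indicator hA'm.compl, ← lintegral_indicator hVm]
          conv_rhs => rw [← lintegral_add_right_eq_self _ (x ^ 3 • Pi.single 0 1)]
          refine lintegral_mono fun s => ?_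
          by_cases hs : s ∈ {s : Fin (N + 1) → ℝ | s 0 ∈ A}ᶜ
          · have hs' : |s 0| ≤ 2 * x := not_lt.1 hs
            rw [Set.indicator_of_mem hs, Set.indicator_of_mem]
            simp only [Set.mem_ofPred_eq, Pi.add_apply, Pi.smul_apply, Pi.single_eq_same,
              smul_eq_mul, mul_one]
            refine (abs_add_le _ _).trans ?_
            rw [abs_of_pos (by positivity : 0 < x ^ 3)]
            linarith
          · rw [Set.indicator_of_notMem hs]
            exact zero_le
        · have hs' : |s 0| ≤ 2 * x := not_lt.1 hs
          exact hs'.trans (by linarith)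
    _ ≤ ENNReal.ofReal (12 * (2 - 2 ^ η)⁻¹) * E + ENNReal.ofReal (12 * (2 - 2 ^ η)⁻¹) * E :=
        add_le_add hball hball
    _ = _ := by ring

lemma mulShear_shift_zero_le (H : BesovBound η f K) (hη0 : 0 < η) (hη1 : η < 1)
    {J : Finset (Fin (N + 1))} (hJ : 0 ∉ J) {x : ℝ} (hx0 : 0 < x) (hx1 : x ≤ 1) :
    ∫⁻ s, ‖mulShear J f (s + x ^ 3 • Pi.single 0 1) - mulShear J f s‖ₑ ≤
      (1 + J.card * 28 + 2 * ENNReal.ofReal (12 * (2 - 2 ^ η)⁻¹)) *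
        (ENNReal.ofReal (x ^ η) * K) := by
  have hAm : MeasurableSet {t : ℝ | 2 * x < |t|} := measurableSet_lt measurable_const (by fun_prop)
  have hA'm : MeasurableSet {s : Fin (N + 1) → ℝ | s 0 ∈ {t : ℝ | 2 * x < |t|}} :=
    measurable_pi_apply 0 hAm
  rw [← lintegral_add_compl _ hA'm, add_mul]
  exact add_le_add (H.mulShear_shift_zero_far_le hη0 hη1 hJ hx0 hx1)
    (H.mulShear_shift_zero_near_le hη0 hη1 hJ hx0 hx1)

lemma mulShear_shift_le (H : BesovBound η f K) (hη0 : 0 < η) (hη1 : η ≤ 1)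
    {J : Finset (Fin (N + 1))} (hJ : 0 ∉ J) {x : ℝ} (hx0 : 0 < x) (hx1 : x ≤ 1)
    {i : Fin (N + 1)} (hi : i ≠ 0) :
    ∫⁻ s, ‖mulShear J f (s + x ^ 3 • Pi.single i 1) - mulShear J f s‖ₑ ≤
      26 * (ENNReal.ofReal (x ^ η) * K) := by
  have hf := H.measurable
  have hgen : ∀ a : ℝ → ℝ, Measurable a → (∀ s : Fin (N + 1) → ℝ,
      dil J (s 0) (s + x ^ 3 • Pi.single i 1) = dil J (s 0) s + a (s 0) • Pi.single i 1) →
      ∫⁻ s, ‖mulShear J f (s + x ^ 3 • Pi.single i 1) - mulShear J f s‖ₑ =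
        ∫⁻ u, ‖f (u + a (u 0) • Pi.single i 1) - f u‖ₑ := by
    intro a ha hdil
    refine Eq.trans ?_ (lintegral_dil_self hJ
      (F := fun u : Fin (N + 1) → ℝ => ‖f (u + a (u 0) • Pi.single i 1) - f u‖ₑ) (by fun_prop))
    refine lintegral_congr fun s => ?_
    have h0 : (s + x ^ 3 • Pi.single i 1 : Fin (N + 1) → ℝ) 0 = s 0 := by simp [hi.symm]
    simp only [mulShear, h0, dil_zero hJ, hdil]
    rw [ofReal_abs_pow_eq_enorm, ← enorm_mul, mul_sub]
  by_cases hiJ : i ∈ J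
  · rw [hgen (fun t => x ^ 3 * t) (by fun_prop) fun s => ?_]
    · exact H.lintegral_shear_sub_le hη0 hη1 hx0 hx1 hi
    · ext k
      by_cases hk : k = i
      · subst hk
        simp [dil, hiJ]
        ring
      · simp [dil, hk]
  · rw [hgen (fun _ => x ^ 3) (by fun_prop) fun s => ?_]
    · refine (H.shift_pow_three_le hη0 hx0 hx1 i).trans (le_mul_of_one_le_left' (by norm_num))
    · ext k
      by_cases hk : k = i
      · subst hk
        simp [dil, hiJ]
      · simp [dil, hk]

end BesovBound

lemma one_add_div_rpow_le {t r δ : ℝ} (ht : 0 ≤ t) (hr : 0 ≤ r) (hδ0 : 0 ≤ δ) (hδ1 : δ ≤ 1) :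
    (1 + t / r) ^ δ ≤ 2 * (1 + t) ^ (3 * δ) + r ^ (-(2 * δ)) := by
  have h1 : (1 + t / r) ^ δ ≤ 1 + (t / r) ^ δ := by
    simpa using Real.rpow_add_le_add_rpow zero_le_one (div_nonneg ht hr) hδ0 hδ1
  have h2 : (t / r) ^ δ = t ^ δ * (r ^ δ)⁻¹ := by
    rw [Real.div_rpow ht hr, div_eq_mul_inv]
  have h3 : r ^ (-(2 * δ)) = ((r ^ δ)⁻¹) ^ 2 := by
    rw [Real.rpow_neg hr, inv_pow, ← Real.rpow_natCast, ← Real.rpow_mul hr, mul_comm δ]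
    norm_num
  have h4 : (t ^ δ) ^ 2 ≤ (1 + t) ^ (3 * δ) := by
    rw [← Real.rpow_natCast, ← Real.rpow_mul ht]
    calc t ^ (δ * (2 : ℕ)) ≤ (1 + t) ^ (δ * (2 : ℕ)) :=
          Real.rpow_le_rpow ht (by linarith) (by positivity)
      _ ≤ _ := Real.rpow_le_rpow_of_exponent_le (by linarith) (by push_cast; linarith)
  have h5 : 1 ≤ (1 + t) ^ (3 * δ) := Real.one_le_rpow (by linarith) (by linarith)
  rw [h3]
  rw [h2] at h1
  nlinarith [sq_nonneg (t ^ δ - (r ^ δ)⁻¹), sq_nonneg (t ^ δ), sq_nonneg ((r ^ δ)⁻¹)]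

namespace BesovBound

variable {N : ℕ} {δ : ℝ} {f : (Fin (N + 1) → ℝ) → ℂ} {K : ℝ≥0∞}

lemma mulShear_moment_le (H : BesovBound (3 * δ) f K) (hδ0 : 0 < δ) (hδ1 : δ ≤ 1)
    {J : Finset (Fin (N + 1))} (hJ : 0 ∉ J) {C : ℝ} (hC : 0 < C)
    (hneg : ∫⁻ s, ENNReal.ofReal (|s 0| ^ (-(2 * δ))) * ‖f s‖ₑ ≤ ENNReal.ofReal C * K)
    (i : Fin (N + 1)) :
    ∫⁻ s, ENNReal.ofReal ((1 + |s i|) ^ δ) * ‖mulShear J f s‖ₑ ≤ ENNReal.ofReal (2 + C) * K := by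
  have hf := H.measurable
  by_cases hi : i ∈ J
  · calc _ = ∫⁻ s, (fun u : Fin (N + 1) → ℝ => ENNReal.ofReal ((1 + |u i| / |u 0|) ^ δ))
            (dil J (s 0) s) * ‖mulShear J f s‖ₑ := by
          refine lintegral_congr fun s => ?_
          rcases eq_or_ne (s 0) 0 with h | h
          · have hcard : J.card ≠ 0 := Finset.card_ne_zero_of_mem hi
            simp [mulShear, h, hcard]
          · have h' : |s 0| ≠ 0 := abs_ne_zero.2 h
            have : |dil J (s 0) s i| / |dil J (s 0) s 0| = |s i| := by
              rw [dil_zero hJ, dil, if_pos hi, abs_mul]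
              field_simp
            simp only [this]
      _ = ∫⁻ u, ENNReal.ofReal ((1 + |u i| / |u 0|) ^ δ) * ‖f u‖ₑ :=
          lintegral_mulShear hJ hf
            (w := fun u : Fin (N + 1) → ℝ => ENNReal.ofReal ((1 + |u i| / |u 0|) ^ δ)) (by fun_prop)
      _ ≤ ∫⁻ u, (2 * (ENNReal.ofReal ((1 + |u i|) ^ (3 * δ)) * ‖f u‖ₑ) +
            ENNReal.ofReal (|u 0| ^ (-(2 * δ))) * ‖f u‖ₑ) := by
          refine lintegral_mono fun u => ?_
          rw [← mul_assoc, ← add_mul]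
          gcongr
          have h2 : (2 : ℝ≥0∞) = ENNReal.ofReal 2 := by simp
          rw [h2, ← ENNReal.ofReal_mul zero_le_two,
            ← ENNReal.ofReal_add (by positivity) (by positivity)]
          exact ENNReal.ofReal_le_ofReal
            (one_add_div_rpow_le (abs_nonneg _) (abs_nonneg _) hδ0.le hδ1)
      _ ≤ 2 * K + ENNReal.ofReal C * K := by
          rw [lintegral_add_left (by fun_prop), lintegral_const_mul _ (by fun_prop)]
          gcongr
          exact H.moment i
      _ = _ := by
          rw [ENNReal.ofReal_add zero_le_two hC.le, add_mul]
          simp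
  · calc _ = ∫⁻ s, (fun u : Fin (N + 1) → ℝ => ENNReal.ofReal ((1 + |u i|) ^ δ))
            (dil J (s 0) s) * ‖mulShear J f s‖ₑ := by
          refine lintegral_congr fun s => ?_
          simp [dil, hi]
      _ = ∫⁻ u, ENNReal.ofReal ((1 + |u i|) ^ δ) * ‖f u‖ₑ :=
          lintegral_mulShear hJ hf
            (w := fun u : Fin (N + 1) → ℝ => ENNReal.ofReal ((1 + |u i|) ^ δ)) (by fun_prop)
      _ ≤ ∫⁻ u, ENNReal.ofReal ((1 + |u i|) ^ (3 * δ)) * ‖f u‖ₑ := by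
          refine lintegral_mono fun u => ?_
          gcongr
          · linarith [abs_nonneg (u i)]
          · linarith
      _ ≤ 1 * K := by simpa using H.moment i
      _ ≤ _ := by
          gcongr
          rw [ENNReal.one_le_ofReal]
          linarith

lemma mulShear_shift_rpow_le (H : BesovBound (3 * δ) f K) (hδ0 : 0 < δ) (hδ1 : 3 * δ < 1)
    {J : Finset (Fin (N + 1))} (hJ : 0 ∉ J) (i : Fin (N + 1)) {h : ℝ} (h0 : 0 < h) (h1 : h ≤ 1) :
    ENNReal.ofReal (h ^ (-δ)) *
        ∫⁻ s, ‖mulShear J f (s + h • Pi.single i 1) - mulShear J f s‖ₑ ≤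
      ENNReal.ofReal ((J.card + 1) * (28 + 24 * (2 - 2 ^ (3 * δ))⁻¹)) * K := by
  have h2 : (2 : ℝ) ^ (3 * δ) < 2 := by
    simpa using Real.rpow_lt_rpow_of_exponent_lt one_lt_two hδ1
  set D : ℝ := (2 - (2 : ℝ) ^ (3 * δ))⁻¹ with hD
  have hD0 : 0 < D := inv_pos.2 (by linarith)
  set x : ℝ := h ^ (3⁻¹ : ℝ) with hx
  have hx0 : 0 < x := by positivity
  have hx1 : x ≤ 1 := Real.rpow_le_one h0.le h1 (by norm_num)
  have hx3 : x ^ 3 = h := by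
    rw [hx, ← Real.rpow_natCast, ← Real.rpow_mul h0.le]
    norm_num
  have hxη : x ^ (3 * δ) = h ^ δ := by
    rw [hx, ← Real.rpow_mul h0.le]
    congr 1
    ring
  have hB : ∫⁻ s, ‖mulShear J f (s + x ^ 3 • Pi.single i 1) - mulShear J f s‖ₑ ≤
      ENNReal.ofReal ((J.card + 1) * (28 + 24 * D)) * (ENNReal.ofReal (x ^ (3 * δ)) * K) := by
    rcases eq_or_ne i 0 with rfl | hi
    · refine (H.mulShear_shift_zero_le (by linarith) hδ1 hJ hx0 hx1).trans ?_
      gcongr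
      calc _ = ENNReal.ofReal (1 + J.card * 28 + 2 * (12 * D)) := by
            rw [ENNReal.ofReal_add (by positivity) (by positivity),
              ENNReal.ofReal_add (by positivity) (by positivity),
              ENNReal.ofReal_mul (by positivity), ENNReal.ofReal_mul zero_le_two]
            simp [hD]
        _ ≤ _ := by
            refine ENNReal.ofReal_le_ofReal ?_
            have : (0 : ℝ) ≤ J.card * D := by positivity
            nlinarith
    · refine (H.mulShear_shift_le (by linarith) hδ1.le hJ hx0 hx1 hi).trans ?_
      gcongr
      rw [← ENNReal.ofReal_ofNat]
      refine ENNReal.ofReal_le_ofReal ?_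
      have : (0 : ℝ) ≤ J.card * D := by positivity
      have : (0 : ℝ) ≤ J.card := by positivity
      nlinarith
  rw [hx3, hxη] at hB
  calc _ ≤ ENNReal.ofReal (h ^ (-δ)) *
        (ENNReal.ofReal ((J.card + 1) * (28 + 24 * D)) * (ENNReal.ofReal (h ^ δ) * K)) := by gcongr
    _ = (ENNReal.ofReal (h ^ (-δ)) * ENNReal.ofReal (h ^ δ)) *
        (ENNReal.ofReal ((J.card + 1) * (28 + 24 * D)) * K) := by ring
    _ = _ := by
        rw [← ENNReal.ofReal_mul (by positivity), ← Real.rpow_add h0]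
        simp

lemma fB_mulShear_le (H : BesovBound (3 * δ) f K) (hδ0 : 0 < δ) (hδ1 : 3 * δ < 1)
    {J : Finset (Fin (N + 1))} (hJ : 0 ∉ J) {C : ℝ} (hC : 0 < C)
    (hneg : ∫⁻ s, ENNReal.ofReal (|s 0| ^ (-(2 * δ))) * ‖f s‖ₑ ≤ ENNReal.ofReal C * K) :
    fB (N + 1) δ (mulShear J f) ≤
      ENNReal.ofReal ((30 + C + 24 * (2 - 2 ^ (3 * δ))⁻¹) * (J.card + 1)) * K := by
  have h2 : (2 : ℝ) ^ (3 * δ) < 2 := by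
    simpa using Real.rpow_lt_rpow_of_exponent_lt one_lt_two hδ1
  have hD0 : 0 < (2 - (2 : ℝ) ^ (3 * δ))⁻¹ := inv_pos.2 (by linarith)
  calc _ ≤ ENNReal.ofReal (2 + C) * K +
        ENNReal.ofReal ((J.card + 1) * (28 + 24 * (2 - 2 ^ (3 * δ))⁻¹)) * K :=
        add_le_add (iSup_le fun i => H.mulShear_moment_le hδ0 (by linarith) hJ hC hneg i)
          (iSup_le fun i => iSup_le fun h =>
            H.mulShear_shift_rpow_le hδ0 hδ1 hJ i h.2.1 h.2.2)
    _ ≤ _ := by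
        rw [← add_mul, ← ENNReal.ofReal_add (by positivity) (by positivity)]
        gcongr
        have : (0 : ℝ) ≤ J.card * (2 + C) := by positivity
        nlinarith

lemma of_fB {ε η : ℝ} (hη : η ≤ ε) (hf : Measurable f) :
    BesovBound η f (fB (N + 1) ε f) where
  measurable := hf
  moment i := by
    refine le_trans ?_ ((le_iSup (fun i : Fin (N + 1) => ∫⁻ s : Fin (N + 1) → ℝ,
      ENNReal.ofReal ((1 + |s i|) ^ ε) * (‖f s‖₊ : ℝ≥0∞)) i).trans le_self_add)
    refine lintegral_mono fun s => ?_
    rw [enorm_eq_nnnorm]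
    gcongr
    linarith [abs_nonneg (s i)]
  shift i h h0 h1 := by
    have hle : ENNReal.ofReal (h ^ (-ε)) * ∫⁻ s, ‖f (s + h • Pi.single i 1) - f s‖ₑ ≤
        fB (N + 1) ε f :=
      le_trans (le_iSup₂ (f := fun (i : Fin (N + 1)) (h : Set.Ioc (0 : ℝ) 1) =>
        ENNReal.ofReal ((h : ℝ) ^ (-ε)) * ∫⁻ s : Fin (N + 1) → ℝ,
          (‖f (s + (h : ℝ) • (Pi.single i 1 : Fin (N + 1) → ℝ)) - f s‖₊ : ℝ≥0∞))
        i ⟨h, h0, h1⟩) le_add_self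
    calc _ = ENNReal.ofReal (h ^ ε) *
          (ENNReal.ofReal (h ^ (-ε)) * ∫⁻ s, ‖f (s + h • Pi.single i 1) - f s‖ₑ) := by
          rw [← mul_assoc, ← ENNReal.ofReal_mul (by positivity), ← Real.rpow_add h0]
          simp
      _ ≤ ENNReal.ofReal (h ^ η) * fB (N + 1) ε f := by
          exact mul_le_mul' (ENNReal.ofReal_le_ofReal
            (Real.rpow_le_rpow_of_exponent_ge h0 h1 hη)) hle

end BesovBound

lemma fB_congr_ae {N : ℕ} {ε : ℝ} {f g : (Fin N → ℝ) → ℂ} (h : f =ᵐ[volume] g) :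
    fB N ε f = fB N ε g := by
  have hshift : ∀ v : Fin N → ℝ, (fun s => f (s + v)) =ᵐ[volume] fun s => g (s + v) := fun v =>
    (measurePreserving_add_right volume v).quasiMeasurePreserving.ae_eq_comp h
  unfold fB
  congr 1
  · refine iSup_congr fun i => lintegral_congr_ae ?_
    filter_upwards [h] with s hs
    rw [hs]
  · refine iSup_congr fun i => iSup_congr fun t => ?_
    congr 1
    refine lintegral_congr_ae ?_
    filter_upwards [h, hshift ((t : ℝ) • Pi.single i 1)] with s hs hs'
    rw [hs, hs']

lemma mulShear_congr_ae {N : ℕ} {J : Finset (Fin (N + 1))} (hJ : 0 ∉ J)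
    {f g : (Fin (N + 1) → ℝ) → ℂ} (h : f =ᵐ[volume] g) :
    mulShear J f =ᵐ[volume] mulShear J g := by
  set Z : Set (Fin (N + 1) → ℝ) := toMeasurable volume {s | f s ≠ g s} with hZ
  have hZ0 : volume Z = 0 := (measure_toMeasurable _).trans h
  have hZm : MeasurableSet Z := measurableSet_toMeasurable _ _
  have hint := lintegral_dil_self hJ (measurable_one.indicator (f := 1) hZm)
  rw [lintegral_indicator_one hZm, hZ0] at hint
  have hae := (lintegral_eq_zero_iff' (by
    have : Measurable (Z.indicator (1 : (Fin (N + 1) → ℝ) → ℝ≥0∞)) := measurable_one.indicator hZm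
    fun_prop)).1 hint
  filter_upwards [hae] with s hs
  simp only [Pi.zero_apply, mul_eq_zero, ENNReal.ofReal_eq_zero, Set.indicator_apply_eq_zero,
    Pi.one_apply, one_ne_zero, imp_false] at hs
  unfold mulShear
  rcases hs with hs | hs
  · have : (s 0 : ℂ) ^ J.card = 0 := by
      have h0 : |s 0| ^ J.card = 0 := le_antisymm hs (by positivity)
      have h1 := ofReal_abs_pow_eq_enorm (s 0) J.card
      rw [h0, ENNReal.ofReal_zero] at h1
      exact enorm_eq_zero.1 h1.symm
    rw [this, zero_mul, zero_mul]
  · have : f (dil J (s 0) s) = g (dil J (s 0) s) := by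
      by_contra hne
      exact hs (subset_toMeasurable _ _ hne)
    rw [this]

lemma integrable_mulShear {N : ℕ} {J : Finset (Fin (N + 1))} (hJ : 0 ∉ J)
    {f : (Fin (N + 1) → ℝ) → ℂ} (hfm : Measurable f) (hf : Integrable f) :
    Integrable (mulShear J f) := by
  refine ⟨(measurable_mulShear J hfm).aestronglyMeasurable, ?_⟩
  have h := lintegral_mulShear hJ hfm (w := fun _ => 1) measurable_const
  simp only [one_mul] at h
  rw [HasFiniteIntegral, h]
  exact hf.2

lemma exists_Mop_eq_mulShear {N n : ℕ} (hn1 : 1 ≤ n) (hn : n ≤ N + 1) :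
    ∃ J : Finset (Fin (N + 1)), 0 ∉ J ∧ J.card + 1 = n ∧ ∀ γ, Mop N n γ = mulShear J γ := by
  set J : Finset (Fin (N + 1)) := Finset.univ.filter fun i => i ≠ 0 ∧ (i : ℕ) < n with hJ
  have hcard : J.card + 1 = n := by
    have h0 : (0 : Fin (N + 1)) ∉ J := by simp [hJ]
    rw [← Finset.card_insert_of_notMem h0]
    have : insert 0 J = Finset.univ.filter fun i : Fin (N + 1) => (i : ℕ) < n := by
      ext i
      by_cases hi : i = 0
      · subst hi
        simp
        omega
      · simp [hJ, hi]
    rw [this, Fin.card_filter_val_lt]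
    omega
  refine ⟨J, by simp [hJ], hcard, fun γ => ?_⟩
  ext s
  have hc : n - 1 = J.card := by omega
  rw [Mop, mulShear, hc, Complex.ofReal_pow]
  congr 2
  ext i
  by_cases hi : i = 0
  · subst hi
    simp [dil, hJ]
  · have hi' : (i : ℕ) ≠ 0 := fun h => hi (Fin.ext h)
    simp [dil, hJ, hi, hi']

/-- `‖Mγ‖_{𝔅_δ(ℝ^N)} ≤ C n ‖γ‖_{𝔅_ε(ℝ^N)}` for `0 < δ < ε/3`, with `C = C(ε,δ)`
independent of the dimension `N` and of `n`. -/
theorem statement7 (ε δ : ℝ) (hε0 : 0 < ε) (hε1 : ε ≤ 1) (hδ0 : 0 < δ) (hδ : δ < ε / 3) :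
    ∃ C : ℝ, 0 < C ∧ ∀ N n : ℕ, 1 ≤ n → n ≤ N + 1 →
      ∀ γ : (Fin (N + 1) → ℝ) → ℂ, Integrable γ volume → fB (N + 1) ε γ ≠ ⊤ →
        Integrable (Mop N n γ) volume ∧
          fB (N + 1) δ (Mop N n γ) ≤ ENNReal.ofReal (C * (n : ℝ)) * fB (N + 1) ε γ := by
  have hδ1 : 3 * δ < 1 := by linarith
  have h2 : (2 : ℝ) ^ (3 * δ) < 2 := by
    simpa using Real.rpow_lt_rpow_of_exponent_lt one_lt_two hδ1
  have hD0 : 0 < (2 - (2 : ℝ) ^ (3 * δ))⁻¹ := inv_pos.2 (by linarith)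
  obtain ⟨C, hC, hneg⟩ := BesovBound.exists_neg_moment_le hδ1 (a := 2 * δ) (by linarith)
    (by linarith)
  refine ⟨30 + C + 24 * (2 - 2 ^ (3 * δ))⁻¹, by positivity, fun N n hn1 hn γ hγ _ => ?_⟩
  obtain ⟨J, hJ, hcard, hMop⟩ := exists_Mop_eq_mulShear hn1 hn
  set f := hγ.1.mk γ with hf
  have hfm : Measurable f := hγ.1.stronglyMeasurable_mk.measurable
  have hγf : γ =ᵐ[volume] f := hγ.1.ae_eq_mk
  have hM := mulShear_congr_ae hJ hγf
  rw [hMop, fB_congr_ae hM, fB_congr_ae hγf, ← hcard]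
  push_cast
  have H : BesovBound (3 * δ) f (fB (N + 1) ε f) := BesovBound.of_fB (by linarith) hfm
  exact ⟨(integrable_mulShear hJ hfm (hγ.congr hγf)).congr hM.symm,
    H.fB_mulShear_le hδ0 hδ1 hJ hC (hneg H 0)⟩

end
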